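/- arXiv:1611.08190 — 2 statements merged into one kernel-verified Lean document; each statement's English description precedes it below -/
import Mathlib

section
/- Let G be a subgroup of Isom(E^{1,2}) such that L restricted to G is injective and L(G) is a discrete subgroup of SO₀(1,2). Let u be a future lightlike vector, p* ∈ ℝ³, Δ = p* + ℝ·u, and p = p* + u. Assume: (i) some g ∈ G with g ≠ 1 fixes Δ pointwise; (ii) every g ∈ G whose linear part maps u to a positive scalar multiple of u fixes Δ pointwise; (iii) there exist a future timelike vector n and a constant C with ⟨g(p*), n⟩ ≤ C for all g ∈ G. Then for every q ∈ ℝ³ the set (G·p) ∩ J⁻(q) is finite; in particular the orbit G·p = {g(p) : g ∈ G} is a closed discrete subset of ℝ³. -/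
noncomputable section

/-- Points/vectors of Minkowski space `E^{1,2}`. -/
abbrev V3 : Type := Fin 3 → ℝ

/-- The Minkowski bilinear form `⟨·,·⟩` of signature `(1,2)`. -/
def mb (v w : V3) : ℝ := -(v 0 * w 0) + v 1 * w 1 + v 2 * w 2

/-- The Minkowski quadratic form. -/
def mq (v : V3) : ℝ := mb v v

def futureTimelike (v : V3) : Prop := mq v < 0 ∧ 0 < v 0
def futureLightlike (v : V3) : Prop := mq v = 0 ∧ 0 < v 0
def futureCausal (v : V3) : Prop := mq v ≤ 0 ∧ 0 < v 0

/-- `SO₀(1,2)`: linear maps preserving the form, of determinant one,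
preserving the future causal cone. -/
def SO12 : Set (Matrix (Fin 3) (Fin 3) ℝ) :=
  {A | (∀ v w, mb (A.mulVec v) (A.mulVec w) = mb v w) ∧ A.det = 1 ∧
       ∀ v, futureCausal v → futureCausal (A.mulVec v)}

/-- A parabolic element of `SO₀(1,2)`. -/
def IsParabolic (A : Matrix (Fin 3) (Fin 3) ℝ) : Prop := A ≠ 1 ∧ (A - 1) ^ 3 = 0

/-- An (affine) isometry of `E^{1,2}` given by its linear part and translation part. -/
abbrev IsomE : Type := Matrix (Fin 3) (Fin 3) ℝ × V3

/-- The action of an isometry on `ℝ³`: `φ(x) = φ_L x + τ_φ`. -/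
def isomApp (g : IsomE) (x : V3) : V3 := g.1.mulVec x + g.2

/-- Composition of isometries. -/
def isomMul (g h : IsomE) : IsomE := (g.1 * h.1, g.1.mulVec h.2 + g.2)

/-- Iterated composition. -/
def isomPow (g : IsomE) : ℕ → IsomE
  | 0 => (1, 0)
  | n + 1 => isomMul g (isomPow g n)

/-- `G` is a subgroup of `Isom(E^{1,2})`. -/
def IsIsomSubgroup (G : Set IsomE) : Prop :=
  (∀ g ∈ G, g.1 ∈ SO12) ∧ ((1 : Matrix (Fin 3) (Fin 3) ℝ), (0 : V3)) ∈ G ∧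
  (∀ g ∈ G, ∀ h ∈ G, isomMul g h ∈ G) ∧
  (∀ g ∈ G, ∃ h ∈ G, isomMul g h = (1, 0) ∧ isomMul h g = (1, 0))

/-- `G` is torsionfree: its only element of finite order is the identity. -/
def IsomTorsionfree (G : Set IsomE) : Prop :=
  ∀ g ∈ G, ∀ n : ℕ, 0 < n → isomPow g n = (1, 0) → g = (1, 0)

/-- The chronological future of the lightlike plane `{x | ⟨x,u⟩ = c}`. -/
def futurePlane (u : V3) (c : ℝ) : Set V3 := {x | mb x u < c}

/-- A regular domain: a nonempty intersection of futures of lightlike planes. -/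
def IsRegularDomain (Ω : Set V3) : Prop :=
  Ω.Nonempty ∧ ∃ Λ : Set (V3 × ℝ), Λ.Nonempty ∧ (∀ p ∈ Λ, futureLightlike p.1) ∧
    Ω = ⋂ p ∈ Λ, futurePlane p.1 p.2

/-- The lightlike line `a + ℝ u`. -/
def linePts (a u : V3) : Set V3 := {x | ∃ s : ℝ, x = a + s • u}

/-- Fixed-point set of an isometry. -/
def FixSet (g : IsomE) : Set V3 := {x | isomApp g x = x}


/-- The causal past of a point: `J⁻(q) = {q} ∪ {y : q - y future causal}`. -/
def Jminus (q : V3) : Set V3 := {y | y = q ∨ futureCausal (q - y)}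

open Topology

/-! ### The Minkowski form and its adjoint -/

/-- The Gram matrix of the Minkowski form. -/
def minkowskiGram : Matrix (Fin 3) (Fin 3) ℝ := Matrix.diagonal ![-1, 1, 1]

/-- The adjoint of a matrix with respect to the Minkowski form. -/
def minkowskiAdjoint (A : Matrix (Fin 3) (Fin 3) ℝ) : Matrix (Fin 3) (Fin 3) ℝ :=
  minkowskiGram * A.transpose * minkowskiGram

lemma continuous_minkowskiAdjoint : Continuous minkowskiAdjoint := by
  unfold minkowskiAdjoint
  fun_prop

lemma minkowskiAdjoint_mul_self {A : Matrix (Fin 3) (Fin 3) ℝ}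
    (hA : ∀ v w, mb (A.mulVec v) (A.mulVec w) = mb v w) : minkowskiAdjoint A * A = 1 := by
  ext i j
  have h := hA (Pi.single i 1) (Pi.single j 1)
  fin_cases i <;> fin_cases j <;>
    simp [mb, minkowskiAdjoint, minkowskiGram, Matrix.mul_apply, Fin.sum_univ_three,
      Matrix.diagonal_apply] at h ⊢ <;> linarith

lemma mb_add_left (v w x : V3) : mb (v + w) x = mb v x + mb w x := by
  simp only [mb, Pi.add_apply]; ring

lemma mb_comm (v w : V3) : mb v w = mb w v := by
  simp only [mb]; ring

lemma mb_sub_left (v w x : V3) : mb (v - w) x = mb v x - mb w x := by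
  simp only [mb, Pi.sub_apply]; ring

lemma eq_of_forall_mb_eq {v w : V3} (h : ∀ y, mb v y = mb w y) : v = w := by
  ext i
  have h := h (Pi.single i 1)
  fin_cases i <;> simpa [mb] using h

lemma mb_nonpos_of_futureCausal {v n : V3} (hv : futureCausal v) (hn : futureTimelike n) :
    mb v n ≤ 0 := by
  obtain ⟨hv, hv0⟩ := hv
  obtain ⟨hn, hn0⟩ := hn
  simp only [mq, mb] at *
  have h : v 1 * n 1 + v 2 * n 2 ≤ v 0 * n 0 := by
    apply le_of_sq_le_sq _ (by positivity)
    nlinarith [sq_nonneg (v 1 * n 2 - v 2 * n 1), mul_nonneg (sq_nonneg (v 0)) (neg_nonneg.2 hn.le),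
      mul_nonneg (add_nonneg (sq_nonneg (n 1)) (sq_nonneg (n 2))) (neg_nonneg.2 hv)]
  linarith

/-- Future causal vectors on one side of a spacelike plane form a bounded set. -/
lemma exists_box_of_le_mb {n : V3} (hn : futureTimelike n) (K : ℝ) :
    ∃ R : ℝ, ∀ v, futureCausal v → -K ≤ mb v n → v ∈ Set.Icc (fun _ => -R) (fun _ : Fin 3 => R) := by
  obtain ⟨hn, hn0⟩ := hn
  simp only [mq, mb] at hn
  set s := Real.sqrt (n 1 ^ 2 + n 2 ^ 2) with hs
  have hs2 : s ^ 2 = n 1 ^ 2 + n 2 ^ 2 := Real.sq_sqrt (by positivity)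
  have hs0 : 0 ≤ s := Real.sqrt_nonneg _
  have hsn : 0 < n 0 - s := by
    have : s < n 0 := lt_of_pow_lt_pow_left₀ 2 hn0.le (by nlinarith)
    linarith
  refine ⟨K / (n 0 - s), fun v ⟨hv, hv0⟩ hK => ?_⟩
  simp only [mq, mb] at hv hK
  have h : v 1 * n 1 + v 2 * n 2 ≤ v 0 * s := by
    apply le_of_sq_le_sq _ (by positivity)
    rw [mul_pow, hs2]
    nlinarith [sq_nonneg (v 1 * n 2 - v 2 * n 1),
      mul_nonneg (add_nonneg (sq_nonneg (n 1)) (sq_nonneg (n 2))) (neg_nonneg.2 hv)]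
  have hR : v 0 ≤ K / (n 0 - s) := by
    rw [le_div_iff₀ hsn]; linarith
  have h1 : |v 1| ≤ v 0 := abs_le_of_sq_le_sq (by nlinarith [sq_nonneg (v 2)]) hv0.le
  have h2 : |v 2| ≤ v 0 := abs_le_of_sq_le_sq (by nlinarith [sq_nonneg (v 1)]) hv0.le
  rw [abs_le] at h1 h2
  constructor <;> intro i <;> fin_cases i <;> simp <;> linarith

/-! ### The Minkowski cross product and parabolic isometries -/

/-- The Minkowski cross product, dual to the determinant. -/
def mcross (v x : V3) : V3 :=
  ![v 2 * x 1 - v 1 * x 2, v 2 * x 0 - v 0 * x 2, v 0 * x 1 - v 1 * x 0]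

lemma mcross_zero_apply (v x : V3) : mcross v x 0 = v 2 * x 1 - v 1 * x 2 := rfl

lemma mcross_one_apply (v x : V3) : mcross v x 1 = v 2 * x 0 - v 0 * x 2 := rfl

lemma mcross_two_apply (v x : V3) : mcross v x 2 = v 0 * x 1 - v 1 * x 0 := rfl

lemma mcross_add_right (v x y : V3) : mcross v (x + y) = mcross v x + mcross v y := by
  ext i; fin_cases i <;> simp [mcross] <;> ring

lemma mcross_smul_right (c : ℝ) (v x : V3) : mcross v (c • x) = c • mcross v x := by
  ext i; fin_cases i <;> simp [mcross] <;> ring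

lemma mb_mcross (v x y : V3) : mb (mcross v x) y = (Matrix.of ![v, x, y]).det := by
  simp [mb, mcross, Matrix.det_fin_three]; ring

lemma mcross_mulVec {A : Matrix (Fin 3) (Fin 3) ℝ} (hA : A ∈ SO12) (v x : V3) :
    mcross (A.mulVec v) (A.mulVec x) = A.mulVec (mcross v x) := by
  have hinv : A * minkowskiAdjoint A = 1 := mul_eq_one_comm.1 (minkowskiAdjoint_mul_self hA.1)
  refine eq_of_forall_mb_eq fun y => ?_
  obtain ⟨z, rfl⟩ : ∃ z, A.mulVec z = y :=
    ⟨(minkowskiAdjoint A).mulVec y, by rw [Matrix.mulVec_mulVec, hinv, Matrix.one_mulVec]⟩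
  rw [hA.1, mb_mcross, mb_mcross]
  have h : Matrix.of ![A.mulVec v, A.mulVec x, A.mulVec z]
      = Matrix.of ![v, x, z] * A.transpose := by
    ext i j
    fin_cases i <;> simp [Matrix.mul_apply, Matrix.mulVec, dotProduct, mul_comm]
  rw [h, Matrix.det_mul, Matrix.det_transpose, hA.2.1, mul_one]

/-- The matrix `exp (c • mcross v)` for a lightlike vector `v`. -/
def parabolicMatrix (c : ℝ) (v : V3) : Matrix (Fin 3) (Fin 3) ℝ :=
  LinearMap.toMatrix' (
    { toFun := fun x => x + c • mcross v x - (c ^ 2 / 2 * mb v x) • v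
      map_add' := fun x y => by
        ext i
        fin_cases i <;>
          simp [mcross_zero_apply, mcross_one_apply, mcross_two_apply, mb] <;> ring
      map_smul' := fun a x => by
        ext i
        fin_cases i <;>
          simp [mcross_zero_apply, mcross_one_apply, mcross_two_apply, mb] <;> ring } : V3 →ₗ[ℝ] V3)

lemma parabolicMatrix_mulVec (c : ℝ) (v x : V3) :
    (parabolicMatrix c v).mulVec x = x + c • mcross v x - (c ^ 2 / 2 * mb v x) • v := by
  rw [parabolicMatrix, LinearMap.toMatrix'_mulVec]
  rfl

lemma parabolicMatrix_apply (c : ℝ) (v : V3) (i j : Fin 3) :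
    parabolicMatrix c v i j = (Pi.single j 1 + c • mcross v (Pi.single j 1)
      - (c ^ 2 / 2 * mb v (Pi.single j 1)) • v : V3) i := by
  rw [← parabolicMatrix_mulVec, Matrix.mulVec_single_one]
  rfl

lemma continuous_parabolicMatrix (c : ℝ) : Continuous (parabolicMatrix c) := by
  refine continuous_matrix fun i j => ?_
  simp only [parabolicMatrix_apply]
  fin_cases i <;> simp [mcross_zero_apply, mcross_one_apply, mcross_two_apply, mb] <;> fun_prop

lemma parabolicMatrix_injective {c : ℝ} (hc : c ≠ 0) : Function.Injective (parabolicMatrix c) := by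
  intro v w h
  have h' (i j : Fin 3) := congrFun (congrFun h i) j
  simp only [parabolicMatrix_apply] at h'
  have h01 := h' 0 1
  have h10 := h' 1 0
  have h02 := h' 0 2
  have h20 := h' 2 0
  have h12 := h' 1 2
  have h21 := h' 2 1
  simp [mcross_zero_apply, mcross_one_apply, mcross_two_apply, mb] at h01 h10 h02 h20 h12 h21
  have h0 : v 0 = w 0 := mul_left_cancel₀ hc (by linarith)
  have h1 : v 1 = w 1 := mul_left_cancel₀ hc (by linarith)
  have h2 : v 2 = w 2 := mul_left_cancel₀ hc (by linarith)
  ext i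
  fin_cases i <;> assumption

lemma mul_parabolicMatrix {A : Matrix (Fin 3) (Fin 3) ℝ} (hA : A ∈ SO12) (c : ℝ) (v : V3) :
    A * parabolicMatrix c v = parabolicMatrix c (A.mulVec v) * A := by
  refine Matrix.ext_of_mulVec_single fun i => ?_
  rw [← Matrix.mulVec_mulVec, ← Matrix.mulVec_mulVec, parabolicMatrix_mulVec,
    parabolicMatrix_mulVec, mcross_mulVec hA, hA.1, Matrix.mulVec_sub, Matrix.mulVec_add,
    Matrix.mulVec_smul, Matrix.mulVec_smul]

/-- An element of `SO₀(1,2)` fixing a lightlike vector `u` is the exponential of a multiple of the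
cross product with `u`. -/
lemma exists_eq_parabolicMatrix {A : Matrix (Fin 3) (Fin 3) ℝ} (hA : A ∈ SO12) {u : V3}
    (hu : futureLightlike u) (hAu : A.mulVec u = u) : ∃ c, A = parabolicMatrix c u := by
  obtain ⟨hq, hr⟩ := hu
  have hiso := hA.1
  set r := u 0 with hr_def
  set a := u 1 with ha_def
  set b := u 2 with hb_def
  have hq : r ^ 2 = a ^ 2 + b ^ 2 := by
    simp only [mq, mb] at hq; linarith
  have hu' : u = ![r, a, b] := by
    ext i; fin_cases i <;> rfl
  let e : V3 := ![0, -b, a]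
  let w : V3 := ![r, -a, -b]
  have hr0 : r ≠ 0 := hr.ne'
  have decomp (x : V3) : ∃ α β : ℝ, x = α • u + β • e + (-mb x u / (2 * r ^ 2)) • w := by
    refine ⟨-mb x w / (2 * r ^ 2), mb x e / r ^ 2, ?_⟩
    ext i
    fin_cases i <;> simp [mb, e, w, hu'] <;> field_simp
    · ring
    · linear_combination (2 * x 1) * hq
    · linear_combination (2 * x 2) * hq
  have huu : mcross u u = 0 := by
    ext i
    fin_cases i <;> simp [mcross, mul_comm]
  have hue : mcross u e = -r • u := by
    ext i
    fin_cases i <;> simp [mcross, e, hu']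
    linear_combination hq
  have huw : mcross u w = (-2 * r) • e := by
    ext i
    fin_cases i <;> simp [mcross, e, w, hu'] <;> ring
  have hwu : mb w u = -2 * r ^ 2 := by
    simp [mb, w, hu']; linear_combination hq
  have hww : mb w w = 0 := by
    simp [mb, w]; linear_combination -hq
  have heu : mb e u = 0 := by
    simp [mb, e, hu']; ring
  have huu' : mb u u = 0 := by
    simp [mb, hu']; linear_combination -hq
  obtain ⟨α, k, hAw⟩ := decomp (A.mulVec w)
  have hγ : mb (A.mulVec w) u = -2 * r ^ 2 := by
    rw [← hwu, ← hiso w u, hAu]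
  rw [hγ, show -(-2 * r ^ 2) / (2 * r ^ 2) = 1 by field_simp, one_smul] at hAw
  have hAe : A.mulVec e = e + (k / 2) • u := by
    have h := mcross_mulVec hA u w
    rw [hAu, hAw, mcross_add_right, mcross_add_right, mcross_smul_right, mcross_smul_right, huu,
      hue, huw, Matrix.mulVec_smul] at h
    ext i
    have h := congrFun h i
    simp at h ⊢
    apply mul_left_cancel₀ hr0
    linear_combination (1 / 2) * h
  have hα : α = k ^ 2 / 4 := by
    have h := hiso w w
    rw [hww, hAw] at h
    simp [mb, e, w, hu'] at h
    apply mul_left_cancel₀ (pow_ne_zero 2 hr0)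
    linear_combination (-1 / 4) * h + -((α - 1) ^ 2 + k ^ 2) / 4 * hq
  refine ⟨-k / (2 * r), Matrix.ext_of_mulVec_single fun i => ?_⟩
  obtain ⟨x, y, hx⟩ := decomp (Pi.single i 1)
  rw [hx]
  simp only [Matrix.mulVec_add, Matrix.mulVec_smul, hAu, hAe, hAw, parabolicMatrix_mulVec, huu, hue,
    huw, mb_comm u e, mb_comm u w, heu, hwu, huu', hα]
  ext i
  simp
  field_simp
  ring

/-! ### Discrete groups of Minkowski isometries -/

/-- A discrete set of linear isometries that is closed under `(A, B) ↦ A⁻¹ * B` meets every compact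
set in a finite set. -/
lemma finite_inter_isCompact {S : Set (Matrix (Fin 3) (Fin 3) ℝ)} (hS : DiscreteTopology S)
    (h1 : 1 ∈ S) (hadj : ∀ A ∈ S, minkowskiAdjoint A * A = 1)
    (hdiv : ∀ A ∈ S, ∀ B ∈ S, minkowskiAdjoint A * B ∈ S)
    {K : Set (Matrix (Fin 3) (Fin 3) ℝ)} (hK : IsCompact K) : (K ∩ S).Finite := by
  have hcont : Continuous fun p : Matrix (Fin 3) (Fin 3) ℝ × Matrix (Fin 3) (Fin 3) ℝ =>
      minkowskiAdjoint p.1 * p.2 :=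
    (continuous_minkowskiAdjoint.comp continuous_fst).mul continuous_snd
  obtain ⟨U, hU, hUS⟩ : ∃ U ∈ 𝓝 (1 : Matrix (Fin 3) (Fin 3) ℝ), U ∩ S = {1} := by
    obtain ⟨U, hUo, hUS⟩ := isOpen_induced_iff.1 (isOpen_discrete ({⟨1, h1⟩} : Set S))
    have hmem (A : Matrix (Fin 3) (Fin 3) ℝ) (hA : A ∈ S) : A ∈ U ↔ A = 1 := by
      simpa using Set.ext_iff.1 hUS ⟨A, hA⟩
    refine ⟨U, hUo.mem_nhds ((hmem 1 h1).2 rfl), ?_⟩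
    ext A
    exact ⟨fun h => (hmem A h.2).1 h.1, by rintro rfl; exact ⟨(hmem 1 h1).2 rfl, h1⟩⟩
  have hloc (A : Matrix (Fin 3) (Fin 3) ℝ) : ∃ V ∈ 𝓝 A, (V ∩ S).Subsingleton := by
    by_cases hA : minkowskiAdjoint A * A = 1
    · have hpre : ∀ᶠ p : Matrix (Fin 3) (Fin 3) ℝ × Matrix (Fin 3) (Fin 3) ℝ in 𝓝 A ×ˢ 𝓝 A,
          minkowskiAdjoint p.1 * p.2 ∈ U := by
        have htend := hcont.tendsto (A, A)
        rw [nhds_prod_eq, hA] at htend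
        exact htend.eventually_mem hU
      obtain ⟨V, hV, hVU⟩ := Filter.eventually_prod_self_iff'.1 hpre
      refine ⟨V, hV, fun B hB C hC => ?_⟩
      have h : minkowskiAdjoint B * C ∈ U ∩ S :=
        ⟨hVU B hB.1 C hC.1, hdiv B hB.2 C hC.2⟩
      rw [hUS, Set.mem_singleton_iff] at h
      calc B = B * (minkowskiAdjoint B * C) := by rw [h, mul_one]
        _ = C := by rw [← mul_assoc, mul_eq_one_comm.1 (hadj B hB.2), one_mul]
    · have hopen : IsOpen {B | minkowskiAdjoint B * B ≠ 1} :=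
        isOpen_ne_fun (continuous_minkowskiAdjoint.mul continuous_id) continuous_const
      refine ⟨_, hopen.mem_nhds hA, fun B hB => absurd (hadj B hB.2) hB.1⟩
  choose V hV hVS using hloc
  obtain ⟨t, -, ht⟩ := hK.elim_nhds_subcover V fun A _ => hV A
  refine (t.finite_toSet.biUnion fun A _ => (hVS A).finite).subset ?_
  rw [← Set.iUnion₂_inter]
  exact Set.inter_subset_inter_left S ht

/-- A set meeting every causal past in a finite set is closed and discrete. -/
lemma isClosed_and_discreteTopology_of_finite_inter_Jminus {S : Set V3}
    (hS : ∀ q, (S ∩ Jminus q).Finite) : IsClosed S ∧ DiscreteTopology S := by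
  have hnhds (x : V3) : Jminus (x + Pi.single 0 1) ∈ 𝓝 x := by
    have hopen : IsOpen {y : V3 | futureTimelike (x + Pi.single 0 1 - y)} := by
      have hq : Continuous fun y : V3 => mq (x + Pi.single 0 1 - y) := by
        unfold mq mb
        fun_prop
      have h0 : Continuous fun y : V3 => (x + Pi.single 0 1 - y : V3) 0 := by
        fun_prop
      exact (isOpen_lt hq continuous_const).inter (isOpen_lt continuous_const h0)
    refine Filter.mem_of_superset (hopen.mem_nhds ?_) fun y hy => Or.inr ⟨hy.1.le, hy.2⟩
    simp [futureTimelike, mq, mb]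
  rw [← isDiscrete_iff_discreteTopology, isClosed_and_discrete_iff]
  intro x
  have hfin : ((S ∩ Jminus (x + Pi.single 0 1)) \ {x}).Finite := (hS _).sdiff
  rw [Filter.disjoint_principal_right, mem_nhdsWithin_iff_exists_mem_nhds_inter]
  refine ⟨_, Filter.inter_mem (hnhds x) (hfin.isClosed.isOpen_compl.mem_nhds (by simp)), ?_⟩
  rintro y ⟨⟨hyJ, hy⟩, hyx⟩ hyS
  exact hy ⟨⟨hyS, hyJ⟩, hyx⟩

lemma isomApp_isomMul (g h : IsomE) (x : V3) :
    isomApp (isomMul g h) x = isomApp g (isomApp h x) := by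
  simp only [isomApp, isomMul, Matrix.mulVec_add, Matrix.mulVec_mulVec, add_assoc]

lemma isomApp_one (x : V3) : isomApp (1, 0) x = x := by
  simp [isomApp]

/-- The orbit of the decorated point `p = p* + u` on the BTZ line
`Δ = p* + ℝu` under `G` meets every causal past in a finite set; in particular
it is a closed discrete subset of `ℝ³`. -/
theorem stmt15 (G : Set IsomE) (hG : IsIsomSubgroup G)
    (hLinj : ∀ g ∈ G, ∀ h ∈ G, g.1 = h.1 → g = h)
    (hLdisc : DiscreteTopology ↥(Prod.fst '' G))
    (u : V3) (hu : futureLightlike u) (pstar : V3)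
    (hi : ∃ g ∈ G, g ≠ ((1 : Matrix (Fin 3) (Fin 3) ℝ), (0 : V3)) ∧
      ∀ x ∈ linePts pstar u, isomApp g x = x)
    (hii : ∀ g ∈ G, (∃ μ : ℝ, 0 < μ ∧ g.1.mulVec u = μ • u) →
      ∀ x ∈ linePts pstar u, isomApp g x = x)
    (hiii : ∃ n : V3, futureTimelike n ∧ ∃ C : ℝ, ∀ g ∈ G, mb (isomApp g pstar) n ≤ C) :
    (∀ q : V3, ((fun g => isomApp g (pstar + u)) '' G ∩ Jminus q).Finite) ∧
    IsClosed ((fun g => isomApp g (pstar + u)) '' G) ∧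
    DiscreteTopology ↥((fun g => isomApp g (pstar + u)) '' G) := by
  obtain ⟨hSO, h1, hmul, hinv⟩ := hG
  obtain ⟨P, hP, hP1, hPfix⟩ := hi
  obtain ⟨n, hn, C, hC⟩ := hiii
  have hPu : P.1.mulVec u = u := by
    have h0 := hPfix pstar ⟨0, by simp⟩
    have h := hPfix (pstar + u) ⟨1, by simp⟩
    simp only [isomApp, Matrix.mulVec_add] at h0 h
    have h' : pstar + P.1.mulVec u = pstar + u := by
      nth_rw 1 [← h, ← h0]
      abel
    exact add_left_cancel h'
  obtain ⟨c, hc⟩ := exists_eq_parabolicMatrix (hSO P hP) hu hPu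
  have hc0 : c ≠ 0 := by
    rintro rfl
    refine hP1 (hLinj P hP _ h1 ?_)
    rw [hc]
    refine Matrix.ext_of_mulVec_single fun i => ?_
    rw [parabolicMatrix_mulVec, Matrix.one_mulVec]
    simp
  have hadj : ∀ A ∈ Prod.fst '' G, minkowskiAdjoint A * A = 1 := by
    rintro _ ⟨g, hg, rfl⟩
    exact minkowskiAdjoint_mul_self (hSO g hg).1
  have hdiv : ∀ A ∈ Prod.fst '' G, ∀ B ∈ Prod.fst '' G,
      minkowskiAdjoint A * B ∈ Prod.fst '' G := by
    rintro _ ⟨g, hg, rfl⟩ _ ⟨h, hh, rfl⟩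
    obtain ⟨k, hk, hgk, -⟩ := hinv g hg
    have hgk : g.1 * k.1 = 1 := congrArg Prod.fst hgk
    have : minkowskiAdjoint g.1 = k.1 := left_inv_eq_right_inv (hadj _ ⟨g, hg, rfl⟩) hgk
    exact ⟨isomMul k h, hmul k hk h hh, by rw [this]; rfl⟩
  have hmem : ∀ g ∈ G, parabolicMatrix c (g.1.mulVec u) ∈ Prod.fst '' G := by
    intro g hg
    obtain ⟨k, hk, hgk, -⟩ := hinv g hg
    have hgk : g.1 * k.1 = 1 := congrArg Prod.fst hgk
    refine ⟨isomMul (isomMul g P) k, hmul _ (hmul g hg P hP) k hk, ?_⟩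
    change g.1 * P.1 * k.1 = _
    rw [hc, mul_parabolicMatrix (hSO g hg), mul_assoc, hgk, mul_one]
  have hfactor : ∀ g ∈ G, ∀ h ∈ G, g.1.mulVec u = h.1.mulVec u →
      isomApp g (pstar + u) = isomApp h (pstar + u) := by
    intro g hg h hh hgh
    obtain ⟨k, hk, hhk, hkh⟩ := hinv h hh
    have hkh : k.1 * h.1 = 1 := congrArg Prod.fst hkh
    have hfix := hii (isomMul k g) (hmul k hk g hg)
      ⟨1, one_pos, by
        change (k.1 * g.1).mulVec u = _
        rw [← Matrix.mulVec_mulVec, hgh, Matrix.mulVec_mulVec, hkh, Matrix.one_mulVec, one_smul]⟩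
      (pstar + u) ⟨1, by simp⟩
    nth_rw 2 [← hfix]
    rw [isomApp_isomMul, ← isomApp_isomMul h, hhk, isomApp_one]
  have hfin : ∀ q : V3, ((fun g => isomApp g (pstar + u)) '' G ∩ Jminus q).Finite := by
    intro q
    obtain ⟨R, hR⟩ := exists_box_of_le_mb hn (C - mb q n)
    have hK : IsCompact (parabolicMatrix c '' Set.Icc (fun _ => -R) (fun _ : Fin 3 => R)) :=
      isCompact_Icc.image (continuous_parabolicMatrix c)
    have hfinite := finite_inter_isCompact hLdisc ⟨_, h1, rfl⟩ hadj hdiv hK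
    let T : Set IsomE := {g | g ∈ G ∧ isomApp g (pstar + u) ∈ Jminus q}
    let F : IsomE → V3 := fun g => g.1.mulVec u
    have hF : (F '' T).Finite := by
      refine Set.Finite.of_finite_image (hfinite.subset ?_)
        (parabolicMatrix_injective hc0).injOn
      rintro _ ⟨_, ⟨g, ⟨hg, hgq⟩, rfl⟩, rfl⟩
      refine ⟨⟨_, hR _ ((hSO g hg).2.2 u ⟨hu.1.le, hu.2⟩) ?_, rfl⟩, hmem g hg⟩
      have hsplit : isomApp g (pstar + u) = isomApp g pstar + g.1.mulVec u := by
        simp only [isomApp, Matrix.mulVec_add]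
        abel
      have hle : mb q n ≤ mb (isomApp g (pstar + u)) n := by
        rcases hgq with h | h
        · rw [h]
        · have := mb_nonpos_of_futureCausal h hn
          rw [mb_sub_left] at this
          linarith
      rw [hsplit, mb_add_left] at hle
      linarith [hC g hg]
    refine (hF.image fun v => isomApp (Function.invFunOn F T v) (pstar + u)).subset ?_
    rintro _ ⟨⟨g, hg, rfl⟩, hgq⟩
    have hgT : F g ∈ F '' T := ⟨g, ⟨hg, hgq⟩, rfl⟩
    exact ⟨F g, hgT, hfactor _ (Function.invFunOn_mem hgT).1 g hg (Function.invFunOn_eq hgT)⟩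
  exact ⟨hfin, isClosed_and_discreteTopology_of_finite_inter_Jminus hfin⟩
end
end

section
/- Let K ⊆ ℝ³ be a nonempty set such that p + v ∈ K for every p ∈ K and every future causal vector v. If w ∈ ℝ³ is nonzero and c ∈ ℝ satisfy ⟨x,w⟩ ≤ c for all x ∈ K, then w is future causal, i.e. q(w) ≤ 0 and the time coordinate of w is positive. In particular, a set which is equal to its own causal future admits no timelike support plane: no plane {x : ⟨x,w⟩ = c} with w spacelike bounds K on one side. -/
noncomputable section

/-- A functional bounded above on a future-closed set is nonpositive on future causal vectors. -/
theorem mb_nonpos_of_bounded {K : Set V3} (hne : K.Nonempty)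
    (hfut : ∀ p ∈ K, ∀ v : V3, futureCausal v → p + v ∈ K)
    {w : V3} {c : ℝ} (hbound : ∀ x ∈ K, mb x w ≤ c) {v : V3} (hv : futureCausal v) :
    mb v w ≤ 0 := by
  obtain ⟨p, hp⟩ := hne
  have mem (n : ℕ) : p + (n : ℝ) • v ∈ K := by
    induction n with
    | zero => simpa using hp
    | succ n ih =>
      have h := hfut _ ih v hv
      simpa [add_smul, add_assoc] using h
  by_contra! h
  obtain ⟨n, hn⟩ := exists_nat_gt ((c - mb p w) / mb v w)
  rw [div_lt_iff₀ h] at hn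
  have hle := hbound _ (mem n)
  simp only [mb, Pi.add_apply, Pi.smul_apply, smul_eq_mul] at hle hn
  linarith

/-- A nonempty set equal to its own causal future admits only causal support
directions: if `⟨x,w⟩ ≤ c` on `K` for some nonzero `w`, then `w` is future
causal. In particular `K` has no timelike (spacelike-normal) support plane. -/
theorem stmt17 (K : Set V3) (hne : K.Nonempty)
    (hfut : ∀ p ∈ K, ∀ v : V3, futureCausal v → p + v ∈ K)
    (w : V3) (hw : w ≠ 0) (c : ℝ) (hbound : ∀ x ∈ K, mb x w ≤ c) :
    mq w ≤ 0 ∧ 0 < w 0 := by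
  have nonpos {v : V3} (hv : futureCausal v) : mb v w ≤ 0 :=
    mb_nonpos_of_bounded hne hfut hbound hv
  have hw0 : 0 ≤ w 0 := by
    have h := nonpos (v := ![1, 0, 0]) (by simp [futureCausal, mq, mb])
    simpa [mb] using h
  set r := √(w 1 ^ 2 + w 2 ^ 2)
  have hr2 : r ^ 2 = w 1 ^ 2 + w 2 ^ 2 := Real.sq_sqrt (by positivity)
  have hr0 : 0 ≤ r := Real.sqrt_nonneg _
  have hrw : r ≤ w 0 := by
    rcases hr0.eq_or_lt with h0 | hpos
    · rwa [← h0]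
    · have h := nonpos (v := ![r, w 1, w 2])
        ⟨by simp [mq, mb]; linarith, by simpa using hpos⟩
      simp [mb] at h
      nlinarith
  refine ⟨by simp only [mq, mb]; nlinarith, hw0.lt_of_ne' fun h0 => hw ?_⟩
  have hsum : w 1 ^ 2 + w 2 ^ 2 = 0 := by
    rw [← hr2, le_antisymm (hrw.trans_eq h0) hr0]
    norm_num
  have h1 : w 1 = 0 := by nlinarith [sq_nonneg (w 1), sq_nonneg (w 2)]
  have h2 : w 2 = 0 := by nlinarith [sq_nonneg (w 1), sq_nonneg (w 2)]
  ext i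
  fin_cases i <;> simp [h0, h1, h2]
end
end
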